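/- Let (u_j)_{j∈ℤ} be a real sequence and A : ℝ → ℝ a strictly increasing continuously differentiable function, and fix ε > 0. For any u ∈ ℝ there exist sequences (τ_j^±)_{j∈ℤ}, (θ_j^±)_{j∈ℤ} such that for each j, τ_j^± and θ_j^± lie in the closed interval with endpoints u_j and u_{j±1}, and D_± sign_ε(A(u_j) − A(u)) = sign_ε'(A(τ_j^±) − A(u)) · D_± A(u_j) and D_± |A(u_j) − A(u)|_ε = sign_ε(A(θ_j^±) − A(u)) · D_± A(u_j). Moreover, if u is a differentiable function of y, then for each j: sign_ε'(A(τ_j^±) − A(u)) · ∂_y A(u) = − ∂_y ( sign_ε(A(θ_j^±) − A(u)) ). -/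

import Mathlib

open MeasureTheory

/-- The Lipschitz approximation of the sign function. -/
noncomputable def signe (ε σ : ℝ) : ℝ :=
  if |σ| < ε then Real.sin (Real.pi * σ / (2 * ε)) else Real.sign σ

/-- `|u|_ε = ∫₀ᵘ sign_ε(z) dz`. -/
noncomputable def abse (ε u : ℝ) : ℝ := ∫ z in (0:ℝ)..u, signe ε z

theorem signe_of_mem_Icc {ε σ : ℝ} (hε : 0 < ε) (h : σ ∈ Set.Icc (-ε) ε) :
    signe ε σ = Real.sin (Real.pi * σ / (2 * ε)) := by
  unfold signe
  split_ifs with h'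
  · rfl
  · rcases le_abs.1 (not_lt.1 h') with h1 | h1
    · obtain rfl : σ = ε := le_antisymm h.2 h1
      rw [Real.sign_of_pos hε, show Real.pi * σ / (2 * σ) = Real.pi / 2 by field_simp,
        Real.sin_pi_div_two]
    · obtain rfl : σ = -ε := le_antisymm (by linarith) h.1
      rw [Real.sign_of_neg (by linarith),
        show Real.pi * -ε / (2 * ε) = -(Real.pi / 2) by field_simp, Real.sin_neg,
        Real.sin_pi_div_two]

theorem signe_of_le {ε σ : ℝ} (hε : 0 < ε) (h : ε ≤ σ) : signe ε σ = 1 := by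
  rw [signe, if_neg (not_lt.2 (h.trans (le_abs_self σ))), Real.sign_of_pos (hε.trans_le h)]

theorem signe_neg (ε σ : ℝ) : signe ε (-σ) = -signe ε σ := by
  unfold signe
  rw [abs_neg, Real.sign_neg, mul_neg, neg_div, Real.sin_neg]
  split_ifs <;> rfl

theorem differentiableAt_signe_of_neg_lt {ε σ : ℝ} (hε : 0 < ε) (hσ : -ε < σ) :
    DifferentiableAt ℝ (signe ε) σ := by
  have hsin : HasDerivAt (fun x => Real.sin (Real.pi * x / (2 * ε)))
      (Real.cos (Real.pi * σ / (2 * ε)) * (Real.pi * 1 / (2 * ε))) σ :=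
    (((hasDerivAt_id σ).const_mul Real.pi).div_const (2 * ε)).sin
  rcases lt_trichotomy σ ε with h | rfl | h
  · refine (hsin.congr_of_eventuallyEq ?_).differentiableAt
    filter_upwards [Icc_mem_nhds hσ h] with x hx using signe_of_mem_Icc hε hx
  · have h0 : Real.cos (Real.pi * σ / (2 * σ)) * (Real.pi * 1 / (2 * σ)) = 0 := by
      rw [show Real.pi * σ / (2 * σ) = Real.pi / 2 by field_simp, Real.cos_pi_div_two, zero_mul]
    rw [h0] at hsin
    have hl : HasDerivWithinAt (signe σ) 0 (Set.Icc (-σ) σ) σ :=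
      hsin.hasDerivWithinAt.congr (fun x hx => signe_of_mem_Icc hε hx)
        (signe_of_mem_Icc hε ⟨hσ.le, le_rfl⟩)
    have hr : HasDerivWithinAt (signe σ) 0 (Set.Ici σ) σ :=
      (hasDerivWithinAt_const σ _ (1 : ℝ)).congr (fun x hx => signe_of_le hε hx)
        (signe_of_le hε le_rfl)
    refine ((hl.union hr).hasDerivAt ?_).differentiableAt
    rw [Set.Icc_union_Ici_eq_Ici hσ.le]
    exact Ici_mem_nhds hσ
  · refine ((hasDerivAt_const σ (1 : ℝ)).congr_of_eventuallyEq ?_).differentiableAt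
    filter_upwards [Ici_mem_nhds h] with x hx using signe_of_le hε hx

theorem differentiable_signe {ε : ℝ} (hε : 0 < ε) : Differentiable ℝ (signe ε) := by
  intro σ
  rcases lt_or_ge (-ε) σ with h | h
  · exact differentiableAt_signe_of_neg_lt hε h
  · have h1 : DifferentiableAt ℝ (signe ε) (-σ) := differentiableAt_signe_of_neg_lt hε (by linarith)
    have h2 : DifferentiableAt ℝ (fun x => -signe ε (-x)) σ :=
      (h1.comp σ differentiableAt_id.neg).neg
    simpa only [signe_neg, neg_neg] using h2

theorem hasDerivAt_abse {ε : ℝ} (hε : 0 < ε) (x : ℝ) : HasDerivAt (abse ε) (signe ε x) x :=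
  (differentiable_signe hε).continuous.integral_hasStrictDerivAt 0 x |>.hasDerivAt

/-- Mean value theorem in unordered form. -/
theorem exists_mem_uIcc_sub_eq_mul {f f' : ℝ → ℝ} (hf : ∀ x, HasDerivAt f (f' x) x) (p q : ℝ) :
    ∃ s ∈ Set.uIcc p q, f q - f p = f' s * (q - p) := by
  wlog h : p ≤ q generalizing p q
  · obtain ⟨s, hs, e⟩ := this q p (not_le.1 h).le
    exact ⟨s, Set.uIcc_comm q p ▸ hs, by linarith⟩
  rcases h.eq_or_lt with rfl | h
  · exact ⟨p, Set.left_mem_uIcc, by simp⟩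
  · obtain ⟨s, hs, e⟩ := exists_hasDerivAt_eq_slope f f' h
      (fun x _ => (hf x).continuousAt.continuousWithinAt) (fun x _ => hf x)
    refine ⟨s, Set.Icc_subset_uIcc (Set.Ioo_subset_Icc_self hs), ?_⟩
    rw [e, div_mul_cancel₀ _ (sub_pos.2 h).ne']

theorem exists_mem_uIcc_comp_sub_eq_mul {f f' A : ℝ → ℝ} (hf : ∀ x, HasDerivAt f (f' x) x)
    (hA : Continuous A) (a b k : ℝ) :
    ∃ t ∈ Set.uIcc a b, f (A b - k) - f (A a - k) = f' (A t - k) * (A b - A a) := by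
  obtain ⟨s, hs, e⟩ := exists_mem_uIcc_sub_eq_mul
    (f := fun x => f (x - k)) (f' := fun x => f' (x - k))
    (fun x => (hf (x - k)).comp_sub_const x k) (A a) (A b)
  obtain ⟨t, ht, rfl⟩ := intermediate_value_uIcc hA.continuousOn hs
  exact ⟨t, ht, e⟩

/-- Chain rule for the intermediate points of the mean value theorem. -/
theorem deriv_mul_deriv_eq_neg_deriv_comp {F f A T Θ w : ℝ → ℝ} {a b : ℝ}
    (hF : ∀ x, HasDerivAt F (f x) x) (hf : Differentiable ℝ f)
    (hA : Differentiable ℝ A) (hAi : Function.Injective A)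
    (hT : ∀ c, T c ∈ Set.uIcc a b) (hΘ : ∀ c, Θ c ∈ Set.uIcc a b)
    (hTe : ∀ c, f (A b - A c) - f (A a - A c) = deriv f (A (T c) - A c) * (A b - A a))
    (hΘe : ∀ c, F (A b - A c) - F (A a - A c) = f (A (Θ c) - A c) * (A b - A a))
    (hw : Differentiable ℝ w) (y : ℝ) :
    deriv f (A (T (w y)) - A (w y)) * deriv (fun y' => A (w y')) y
      = -deriv (fun y' => f (A (Θ (w y')) - A (w y'))) y := by
  have hv : HasDerivAt (fun y' => A (w y')) (deriv (fun y' => A (w y')) y) y :=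
    ((hA (w y)).comp y (hw y)).hasDerivAt
  set d := deriv (fun y' => A (w y')) y
  have key : HasDerivAt (fun y' => f (A (Θ (w y')) - A (w y')))
      (-(deriv f (A (T (w y)) - A (w y)) * d)) y := by
    rcases eq_or_ne a b with rfl | hab
    · simp only [Set.uIcc_self, Set.mem_singleton_iff] at hT hΘ
      simp only [hT, hΘ]
      have h := (hf (A a - A (w y))).hasDerivAt.comp y (hv.const_sub (A a))
      rwa [mul_neg] at h
    · have hne : A b - A a ≠ 0 := sub_ne_zero.2 (hAi.ne hab.symm)
      have h := (((hF (A b - A (w y))).comp y (hv.const_sub (A b))).sub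
        ((hF (A a - A (w y))).comp y (hv.const_sub (A a)))).div_const (A b - A a)
      refine (h.congr_deriv ?_).congr_of_eventuallyEq
        (.of_forall fun y' => eq_div_of_mul_eq hne (hΘe (w y')).symm)
      rw [div_eq_iff hne]
      linear_combination -d * hTe (w y)
  rw [key.deriv, neg_neg]

/-- the discrete mean-value lemma (Lemma `DifQuotChainRule`):
existence of intermediate points `τ_j^±`, `θ_j^±` for the difference quotients of
`sign_ε(A(u_j) − A(u))` and `|A(u_j) − A(u)|_ε`, together with the chain-rule
identity when `u` is a differentiable function of `y`. -/
theorem stmt_11 (Δx : ℝ) (hΔx : 0 < Δx) (ε : ℝ) (hε : 0 < ε)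
    (A : ℝ → ℝ) (hA : ContDiff ℝ 1 A) (hAmono : StrictMono A)
    (u : ℤ → ℝ) :
    ∃ τp τm θp θm : ℤ → ℝ → ℝ,
      (∀ (c : ℝ) (j : ℤ),
        (τp j c ∈ Set.uIcc (u j) (u (j+1)) ∧ τm j c ∈ Set.uIcc (u j) (u (j-1)) ∧
          θp j c ∈ Set.uIcc (u j) (u (j+1)) ∧ θm j c ∈ Set.uIcc (u j) (u (j-1))) ∧
        ((signe ε (A (u (j+1)) - A c) - signe ε (A (u j) - A c)) / Δx
            = deriv (signe ε) (A (τp j c) - A c) * ((A (u (j+1)) - A (u j)) / Δx)) ∧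
        ((signe ε (A (u j) - A c) - signe ε (A (u (j-1)) - A c)) / Δx
            = deriv (signe ε) (A (τm j c) - A c) * ((A (u j) - A (u (j-1))) / Δx)) ∧
        ((abse ε (A (u (j+1)) - A c) - abse ε (A (u j) - A c)) / Δx
            = signe ε (A (θp j c) - A c) * ((A (u (j+1)) - A (u j)) / Δx)) ∧
        ((abse ε (A (u j) - A c) - abse ε (A (u (j-1)) - A c)) / Δx
            = signe ε (A (θm j c) - A c) * ((A (u j) - A (u (j-1))) / Δx))) ∧
      (∀ w : ℝ → ℝ, Differentiable ℝ w → ∀ (j : ℤ) (y : ℝ),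
        (deriv (signe ε) (A (τp j (w y)) - A (w y)) * deriv (fun y' => A (w y')) y
            = - deriv (fun y' => signe ε (A (θp j (w y')) - A (w y'))) y) ∧
        (deriv (signe ε) (A (τm j (w y)) - A (w y)) * deriv (fun y' => A (w y')) y
            = - deriv (fun y' => signe ε (A (θm j (w y')) - A (w y'))) y)) := by
  have hS := differentiable_signe hε
  have hAd : Differentiable ℝ A := hA.differentiable one_ne_zero
  choose T hT hTe using fun a b c : ℝ =>
    exists_mem_uIcc_comp_sub_eq_mul (fun x => (hS x).hasDerivAt) hA.continuous a b (A c)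
  choose Θ hΘ hΘe using fun a b c : ℝ =>
    exists_mem_uIcc_comp_sub_eq_mul (hasDerivAt_abse hε) hA.continuous a b (A c)
  refine ⟨fun j => T (u j) (u (j+1)), fun j => T (u j) (u (j-1)),
    fun j => Θ (u j) (u (j+1)), fun j => Θ (u j) (u (j-1)), fun c j =>
    ⟨⟨hT _ _ _, hT _ _ _, hΘ _ _ _, hΘ _ _ _⟩, ?_, ?_, ?_, ?_⟩, fun w hw j y => ⟨?_, ?_⟩⟩
  · rw [hTe, mul_div_assoc]
  · rw [← mul_div_assoc]
    congr 1
    linear_combination -hTe (u j) (u (j-1)) c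
  · rw [hΘe, mul_div_assoc]
  · rw [← mul_div_assoc]
    congr 1
    linear_combination -hΘe (u j) (u (j-1)) c
  all_goals
    exact deriv_mul_deriv_eq_neg_deriv_comp (hasDerivAt_abse hε) hS hAd hAmono.injective
      (hT _ _) (hΘ _ _) (hTe _ _) (hΘe _ _) hw y
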